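/- Let I₁ be a nonempty finite set of matched pairs (t_e, t_u). Suppose the outcome model is Y_t(e) = β_0 + β_1·e + β_2·t + ⟨β_3, W_t⟩ + ⟨β_4, X_t⟩ + ⟨β_5, P_t⟩ + ε_t(e) with E[ε_t(e) | data] = 0, where W_t ∈ ℝ^{p_W}, X_t ∈ ℝ^{p_X}, P_t ∈ ℝ^{p_P}. Suppose the matching satisfies: |Σ_{I₁}(t_e − t_u)| ≤ δ|I₁|, and componentwise |Σ_{I₁}(W_{t_e} − W_{t_u})| ≤ δ'|I₁|·1, |Σ_{I₁}(X_{t_e} − X_{t_u})| ≤ δ'|I₁|·1, |Σ_{I₁}(P_{t_e} − P_{t_u})| ≤ δ'|I₁|·1. Then the 1-1 matching estimator τ̂ = (1/|I₁|)Σ_{I₁}(Y_{t_e} − Y_{t_u}) (with exposed outcomes Y_{t_e} = Y_{t_e}(1) and unexposed Y_{t_u} = Y_{t_u}(0)) satisfies |E[τ̂ − τ]| ≤ δ|β_2| + δ'(‖β_3‖₁ + ‖β_4‖₁ + ‖β_5‖₁), where τ = β_1. -/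

import Mathlib

open MeasureTheory

theorem m11_aux {n : ℕ} (I : Finset (ℝ × ℝ)) (b : Fin n → ℝ) (W : ℝ → Fin n → ℝ) (d : ℝ)
    (h : ∀ i, |∑ p ∈ I, (W p.1 i - W p.2 i)| ≤ d) :
    |∑ p ∈ I, ((∑ i, b i * W p.1 i) - ∑ i, b i * W p.2 i)| ≤ d * ∑ i, |b i| := by
  have e : ∑ p ∈ I, ((∑ i, b i * W p.1 i) - ∑ i, b i * W p.2 i)
      = ∑ i, b i * ∑ p ∈ I, (W p.1 i - W p.2 i) := by
    simp_rw [← Finset.sum_sub_distrib, ← mul_sub]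
    rw [Finset.sum_comm]
    simp_rw [Finset.mul_sum]
  rw [e, Finset.mul_sum]
  refine (Finset.abs_sum_le_sum_abs _ _).trans (Finset.sum_le_sum fun i _ => ?_)
  rw [abs_mul, mul_comm]
  exact mul_le_mul_of_nonneg_right (h i) (abs_nonneg _)

/-- Theorem 1 (bias bound under a linear outcome model) for the Matching 1-1 estimator:
under average balance of time and all time-varying covariates, the bias of the 1-1
matching estimator is bounded by δ|β₂| + δ'(‖β₃‖₁ + ‖β₄‖₁ + ‖β₅‖₁). -/
theorem matching11_bias_linear
    {Ω : Type*} [MeasurableSpace Ω] (μ : Measure Ω) [IsProbabilityMeasure μ]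
    {pW pX pP : ℕ}
    (I₁ : Finset (ℝ × ℝ)) (hI : I₁.Nonempty)
    (β0 β1 β2 : ℝ) (β3 : Fin pW → ℝ) (β4 : Fin pX → ℝ) (β5 : Fin pP → ℝ)
    (δ δ' : ℝ) (hδ : 0 ≤ δ) (hδ' : 0 ≤ δ')
    (W : ℝ → Fin pW → ℝ) (X : ℝ → Fin pX → ℝ) (P : ℝ → Fin pP → ℝ)
    (ε : ℝ → ℝ → Ω → ℝ)
    (hint : ∀ t e, Integrable (ε t e) μ)
    (hmean : ∀ t e, ∫ ω, ε t e ω ∂μ = 0)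
    (Y : ℝ → ℝ → Ω → ℝ)
    (hY : ∀ t e ω, Y t e ω
      = β0 + β1 * e + β2 * t + (∑ i, β3 i * W t i) + (∑ i, β4 i * X t i)
        + (∑ i, β5 i * P t i) + ε t e ω)
    (hbal_t : |∑ p ∈ I₁, (p.1 - p.2)| ≤ δ * I₁.card)
    (hbal_W : ∀ i, |∑ p ∈ I₁, (W p.1 i - W p.2 i)| ≤ δ' * I₁.card)
    (hbal_X : ∀ i, |∑ p ∈ I₁, (X p.1 i - X p.2 i)| ≤ δ' * I₁.card)
    (hbal_P : ∀ i, |∑ p ∈ I₁, (P p.1 i - P p.2 i)| ≤ δ' * I₁.card) :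
    |(∫ ω, (I₁.card : ℝ)⁻¹ * ∑ p ∈ I₁, (Y p.1 1 ω - Y p.2 0 ω) ∂μ) - β1|
      ≤ δ * |β2| + δ' * ((∑ i, |β3 i|) + (∑ i, |β4 i|) + (∑ i, |β5 i|)) := by
  have hc : (0 : ℝ) < I₁.card := by exact_mod_cast hI.card_pos
  have hYi : ∀ t e, Integrable (Y t e) μ := by
    intro t e
    rw [funext (hY t e)]
    exact (integrable_const _).add (hint t e)
  have hYm : ∀ t e, ∫ ω, Y t e ω ∂μ = β0 + β1 * e + β2 * t + (∑ i, β3 i * W t i)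
      + (∑ i, β4 i * X t i) + (∑ i, β5 i * P t i) := by
    intro t e
    simp_rw [hY t e]
    rw [integral_add (integrable_const _) (hint t e), hmean]
    simp
  have hA := m11_aux I₁ β3 W _ hbal_W
  have hB := m11_aux I₁ β4 X _ hbal_X
  have hC := m11_aux I₁ β5 P _ hbal_P
  set A := ∑ p ∈ I₁, ((∑ i, β3 i * W p.1 i) - ∑ i, β3 i * W p.2 i) with hAd
  set B := ∑ p ∈ I₁, ((∑ i, β4 i * X p.1 i) - ∑ i, β4 i * X p.2 i) with hBd
  set C := ∑ p ∈ I₁, ((∑ i, β5 i * P p.1 i) - ∑ i, β5 i * P p.2 i) with hCd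
  set T := ∑ p ∈ I₁, (p.1 - p.2) with hTd
  have key : ∫ ω, (I₁.card : ℝ)⁻¹ * ∑ p ∈ I₁, (Y p.1 1 ω - Y p.2 0 ω) ∂μ
      = (I₁.card : ℝ)⁻¹ * (I₁.card * β1 + β2 * T + A + B + C) := by
    rw [integral_const_mul, integral_finsetSum _ (fun p _ => (hYi p.1 1).sub (hYi p.2 0))]
    congr 1
    have e1 : (I₁.card : ℝ) * β1 = ∑ p ∈ I₁, β1 := by simp
    rw [e1, hAd, hBd, hCd, hTd, Finset.mul_sum, ← Finset.sum_add_distrib,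
      ← Finset.sum_add_distrib, ← Finset.sum_add_distrib, ← Finset.sum_add_distrib]
    refine Finset.sum_congr rfl fun p _ => ?_
    rw [integral_sub (hYi p.1 1) (hYi p.2 0), hYm, hYm]
    ring
  have e2 : (I₁.card : ℝ)⁻¹ * (I₁.card * β1 + β2 * T + A + B + C) - β1
      = (β2 * T + A + B + C) / I₁.card := by
    field_simp
    ring
  rw [key, e2, abs_div, abs_of_pos hc, div_le_iff₀ hc]
  have hT : |β2 * T| ≤ |β2| * (δ * I₁.card) := by
    rw [abs_mul]
    exact mul_le_mul_of_nonneg_left hbal_t (abs_nonneg _)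
  have h1 := abs_add_le (β2 * T + A + B) C
  have h2 := abs_add_le (β2 * T + A) B
  have h3 := abs_add_le (β2 * T) A
  linarith
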